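/- arXiv:1104.5700 — 3 statements merged into one kernel-verified Lean document; each statement's English description precedes it below -/
import Mathlib

section
/- For every n ≥ 2 and all P, Q ∈ Γₙ, one has (1/16)Ψ(P||Q) − h(P||Q) ≤ (12/11)[(1/16)Ψ(P||Q) − 4d(P||Q)]. -/
open Real BigOperators Finset

/-- The set of positive probability distributions on `Fin n`. -/
def ProbDist (n : ℕ) : Set (Fin n → ℝ) :=
  {p | (∀ i, 0 < p i) ∧ ∑ i, p i = 1}

/-- Triangular discrimination `Δ(P‖Q)`. -/
noncomputable def triDelta {n : ℕ} (p q : Fin n → ℝ) : ℝ :=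
  ∑ i, (p i - q i) ^ 2 / (p i + q i)

/-- Hellinger discrimination `h(P‖Q)`. -/
noncomputable def hellinger {n : ℕ} (p q : Fin n → ℝ) : ℝ :=
  (1 / 2) * ∑ i, (Real.sqrt (p i) - Real.sqrt (q i)) ^ 2

/-- Jensen–Shannon divergence `I(P‖Q)`. -/
noncomputable def jsDiv {n : ℕ} (p q : Fin n → ℝ) : ℝ :=
  (1 / 2) * ((∑ i, p i * Real.log (2 * p i / (p i + q i))) +
    ∑ i, q i * Real.log (2 * q i / (p i + q i)))

/-- J-divergence `J(P‖Q)`. -/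
noncomputable def jDiv {n : ℕ} (p q : Fin n → ℝ) : ℝ :=
  ∑ i, (p i - q i) * Real.log (p i / q i)

/-- Arithmetic–geometric mean divergence `T(P‖Q)`. -/
noncomputable def agDiv {n : ℕ} (p q : Fin n → ℝ) : ℝ :=
  ∑ i, ((p i + q i) / 2) * Real.log ((p i + q i) / (2 * Real.sqrt (p i * q i)))

/-- Symmetric chi-square divergence `Ψ(P‖Q)`. -/
noncomputable def psiDiv {n : ℕ} (p q : Fin n → ℝ) : ℝ :=
  ∑ i, (p i - q i) ^ 2 * (p i + q i) / (p i * q i)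

/-- The d-divergence `d(P‖Q)`. -/
noncomputable def dDiv {n : ℕ} (p q : Fin n → ℝ) : ℝ :=
  1 - ∑ i, ((Real.sqrt (p i) + Real.sqrt (q i)) / 2) * Real.sqrt ((p i + q i) / 2)

/-- Polynomial form of the inequality, where `s` is the arithmetic and `m` the quadratic mean. -/
theorem mean_poly_inequality {s m : ℝ} (hs : 0 < s) (hsm : s ≤ m) (hms : m ^ 2 ≤ 2 * s ^ 2) :
    (48 * (m ^ 2 - s * m) - 22 * (m ^ 2 - s ^ 2)) * (2 * s ^ 2 - m ^ 2) ^ 2 ≤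
      2 * s ^ 2 * (m ^ 2 - s ^ 2) * m ^ 2 := by
  have hm : 0 < m := hs.trans_le hsm
  have hfac : 0 ≤ -13 * m ^ 3 - 15 * m ^ 2 * s + 36 * m * s ^ 2 + 44 * s ^ 3 := by
    have h₁ := mul_nonneg hm.le (sub_nonneg.2 hms)
    have h₂ := mul_nonneg hs.le (sub_nonneg.2 hms)
    have h₃ : 0 < m * s ^ 2 := by positivity
    have h₄ : 0 < s ^ 3 := by positivity
    linarith
  have h := mul_nonneg (pow_nonneg (sub_nonneg.2 hsm) 3) hfac
  linarith

/-- Pointwise form of the inequality `48 d ≤ Ψ / 16 + 11 h`. -/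
theorem dDiv_term_le {x y : ℝ} (hx : 0 < x) (hy : 0 < y) :
    48 * ((x + y) / 2 - ((√x + √y) / 2) * √((x + y) / 2)) ≤
      (1 / 16) * ((x - y) ^ 2 * (x + y) / (x * y)) + 11 / 2 * (√x - √y) ^ 2 := by
  obtain ⟨a, ha, rfl⟩ : ∃ a : ℝ, 0 < a ∧ x = a ^ 2 := ⟨√x, sqrt_pos.2 hx, (sq_sqrt hx.le).symm⟩
  obtain ⟨b, hb, rfl⟩ : ∃ b : ℝ, 0 < b ∧ y = b ^ 2 := ⟨√y, sqrt_pos.2 hy, (sq_sqrt hy.le).symm⟩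
  rw [sqrt_sq ha.le, sqrt_sq hb.le]
  obtain ⟨m, hm⟩ : ∃ m, m = √((a ^ 2 + b ^ 2) / 2) := ⟨_, rfl⟩
  obtain ⟨s, hs⟩ : ∃ s, s = (a + b) / 2 := ⟨_, rfl⟩
  rw [← hm, ← hs]
  have hm2 : m ^ 2 = (a ^ 2 + b ^ 2) / 2 := by rw [hm, sq_sqrt (by positivity)]
  have hab : 0 < a * b := mul_pos ha hb
  have hprod : 2 * s ^ 2 - m ^ 2 = a * b := by rw [hm2, hs]; ring
  have hdiff : 4 * (m ^ 2 - s ^ 2) = (a - b) ^ 2 := by rw [hm2, hs]; ring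
  have hsm : s ≤ m := by
    rw [hm]
    exact le_sqrt_of_sq_le (by rw [← hm2]; linarith [sq_nonneg (a - b)])
  have key := mean_poly_inequality (by rw [hs]; positivity) hsm (by linarith)
  have hnum : 2 * s ^ 2 * (m ^ 2 - s ^ 2) * m ^ 2 =
      (1 / 16) * ((a ^ 2 - b ^ 2) ^ 2 * (a ^ 2 + b ^ 2)) := by rw [hm2, hs]; ring
  rw [hprod, hnum, ← le_div_iff₀ (by positivity), mul_pow, mul_div_assoc] at key
  rw [← hm2]
  linarith

theorem D_Psih_le_D_Psid (n : ℕ) (hn : 2 ≤ n)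
    (p q : Fin n → ℝ) (hp : p ∈ ProbDist n) (hq : q ∈ ProbDist n) :
    (1 / 16) * psiDiv p q - hellinger p q ≤
      (12 / 11) * ((1 / 16) * psiDiv p q - 4 * dDiv p q) := by
  have hsum := Finset.sum_le_sum fun i (_ : i ∈ Finset.univ) => dDiv_term_le (hp.1 i) (hq.1 i)
  rw [← Finset.mul_sum, Finset.sum_sub_distrib, ← Finset.sum_div, Finset.sum_add_distrib,
    hp.2, hq.2, Finset.sum_add_distrib, ← Finset.mul_sum, ← Finset.mul_sum] at hsum
  unfold psiDiv hellinger dDiv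
  linarith
end

section
/- For every n ≥ 2 and all P, Q ∈ Γₙ, the following chain of inequalities holds: I(P||Q) ≤ (16d(P||Q) + 3I(P||Q))/7 ≤ h(P||Q) ≤ (64d(P||Q) + Δ(P||Q))/20 ≤ 4d(P||Q) ≤ (32d(P||Q) + T(P||Q))/9 ≤ (1/8)J(P||Q). -/
open Real BigOperators Finset

theorem nonneg_of_hasDerivAt_nonneg_Ico {f f' : ℝ → ℝ} {b : ℝ}
    (hf : ∀ x, 0 ≤ x → x < b → HasDerivAt f (f' x) x)
    (hf' : ∀ x, 0 ≤ x → x < b → 0 ≤ f' x) (h0 : f 0 = 0) {t : ℝ} (ht : 0 ≤ t) (htb : t < b) :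
    0 ≤ f t := by
  have hmono : MonotoneOn f (Set.Icc 0 t) := by
    refine monotoneOn_of_hasDerivWithinAt_nonneg (f' := f') (convex_Icc 0 t) ?_ ?_ ?_
    · exact fun x hx => (hf x hx.1 (hx.2.trans_lt htb)).continuousAt.continuousWithinAt
    · intro x hx
      rw [interior_Icc] at hx
      exact (hf x hx.1.le (hx.2.trans htb)).hasDerivWithinAt
    · intro x hx
      rw [interior_Icc] at hx
      exact hf' x hx.1.le (hx.2.trans htb)
  simpa [h0] using hmono (Set.left_mem_Icc.2 ht) (Set.right_mem_Icc.2 ht) ht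

theorem hasDerivAt_log_one_add {x : ℝ} (hx : 0 < 1 + x) :
    HasDerivAt (fun y : ℝ => log (1 + y)) (1 / (1 + x)) x :=
  ((hasDerivAt_id x).const_add 1).log hx.ne'

theorem hasDerivAt_log_one_sub {x : ℝ} (hx : 0 < 1 - x) :
    HasDerivAt (fun y : ℝ => log (1 - y)) (-1 / (1 - x)) x :=
  ((hasDerivAt_id x).const_sub 1).log hx.ne'

theorem hasDerivAt_log_one_add_sq (x : ℝ) :
    HasDerivAt (fun y : ℝ => log (1 + y ^ 2)) (2 * x / (1 + x ^ 2)) x := by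
  simpa using ((hasDerivAt_pow 2 x).const_add 1).log (by positivity : (1 + x ^ 2) ≠ 0)

theorem two_mul_add_le_log_sub_log {t : ℝ} (ht : 0 ≤ t) (ht1 : t < 1) :
    2 * t + 2 / 3 * t ^ 3 ≤ log (1 + t) - log (1 - t) := by
  have key : 0 ≤ log (1 + t) - log (1 - t) - (2 * t + 2 / 3 * t ^ 3) := by
    refine nonneg_of_hasDerivAt_nonneg_Ico (b := 1)
      (f := fun x => log (1 + x) - log (1 - x) - (2 * x + 2 / 3 * x ^ 3))
      (f' := fun x => 2 * x ^ 4 / (1 - x ^ 2)) ?_ ?_ (by simp) ht ht1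
    · intro x hx hx1
      have h1 : 0 < 1 + x := by linarith
      have h2 : 0 < 1 - x := by linarith
      refine (((hasDerivAt_log_one_add h1).sub (hasDerivAt_log_one_sub h2)).sub
        (((hasDerivAt_id x).const_mul 2).add
          ((hasDerivAt_pow 3 x).const_mul (2 / 3)))).congr_deriv ?_
      rw [show 1 - x ^ 2 = (1 + x) * (1 - x) by ring]
      field_simp
      push_cast
      ring
    · intro x hx hx1
      have : 0 < 1 - x ^ 2 := by nlinarith
      positivity
  linarith

theorem one_sub_sq_mul_log_sub_log_le {t : ℝ} (ht : 0 ≤ t) (ht1 : t < 1) :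
    (1 - t ^ 2) * (log (1 + t) - log (1 - t)) ≤ 2 * (t - 2 / 3 * t ^ 3 - 1 / 12 * t ^ 5) := by
  have key : 0 ≤ 2 * ((t - 2 / 3 * t ^ 3 - 1 / 12 * t ^ 5) / (1 - t ^ 2))
      - (log (1 + t) - log (1 - t)) := by
    refine nonneg_of_hasDerivAt_nonneg_Ico (b := 1)
      (f := fun x => 2 * ((x - 2 / 3 * x ^ 3 - 1 / 12 * x ^ 5) / (1 - x ^ 2))
        - (log (1 + x) - log (1 - x)))
      (f' := fun x => (x ^ 4 + x ^ 6) / 2 / (1 - x ^ 2) ^ 2) ?_ ?_ (by simp) ht ht1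
    · intro x hx hx1
      have h1 : 0 < 1 + x := by linarith
      have h2 : 0 < 1 - x := by linarith
      have h3 : 1 - x ^ 2 = (1 + x) * (1 - x) := by ring
      have h4 : 1 - x ^ 2 ≠ 0 := by rw [h3]; positivity
      refine ((((((hasDerivAt_id x).sub ((hasDerivAt_pow 3 x).const_mul (2 / 3))).sub
        ((hasDerivAt_pow 5 x).const_mul (1 / 12))).div
        ((hasDerivAt_pow 2 x).const_sub 1) h4).const_mul 2).sub
        ((hasDerivAt_log_one_add h1).sub (hasDerivAt_log_one_sub h2))).congr_deriv ?_
      simp only [id, Pi.sub_apply]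
      rw [h3]
      field_simp
      push_cast
      ring
    · intro x hx hx1
      positivity
  have h : 0 < 1 - t ^ 2 := by nlinarith
  have := mul_nonneg h.le key
  field_simp at this
  linarith

theorem jensenShannon_poly_bound_of_nonneg {t : ℝ} (ht : 0 ≤ t) (ht1 : t < 1) :
    3 * (2 * t * (log (1 + t) - log (1 - t))
      + (1 + t ^ 2) * (log (1 + t) + log (1 - t) - log (1 + t ^ 2)))
      ≤ 6 * t ^ 2 - 2 * t ^ 4 + t ^ 6 / 2 := by
  have key : 0 ≤ (6 * t ^ 2 - 2 * t ^ 4 + 1 / 2 * t ^ 6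
      - 6 * (t * (log (1 + t) - log (1 - t)))) / (1 + t ^ 2)
      - 3 * (log (1 + t) + log (1 - t) - log (1 + t ^ 2)) := by
    refine nonneg_of_hasDerivAt_nonneg_Ico (b := 1)
      (f := fun x => (6 * x ^ 2 - 2 * x ^ 4 + 1 / 2 * x ^ 6
        - 6 * (x * (log (1 + x) - log (1 - x)))) / (1 + x ^ 2)
        - 3 * (log (1 + x) + log (1 - x) - log (1 + x ^ 2)))
      (f' := fun x => (2 * x * (6 - 4 * x ^ 2 - 1 / 2 * x ^ 4 + x ^ 6)
        - 6 * ((1 - x ^ 2) * (log (1 + x) - log (1 - x)))) / (1 + x ^ 2) ^ 2)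
      ?_ ?_ (by simp) ht ht1
    · intro x hx hx1
      have h1 : 0 < 1 + x := by linarith
      have h2 : 0 < 1 - x := by linarith
      have h3 : (1 + x ^ 2) ≠ 0 := by positivity
      refine (((((((hasDerivAt_pow 2 x).const_mul 6).sub ((hasDerivAt_pow 4 x).const_mul 2)).add
        ((hasDerivAt_pow 6 x).const_mul (1 / 2))).sub
        (((hasDerivAt_id x).mul
          ((hasDerivAt_log_one_add h1).sub (hasDerivAt_log_one_sub h2))).const_mul 6)).div
        ((hasDerivAt_pow 2 x).const_add 1) h3).sub
        ((((hasDerivAt_log_one_add h1).add (hasDerivAt_log_one_sub h2)).sub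
          (hasDerivAt_log_one_add_sq x)).const_mul 3)).congr_deriv ?_
      simp only [id, Pi.sub_apply, Pi.add_apply, Pi.mul_apply]
      field_simp
      push_cast
      ring
    · intro x hx hx1
      have := one_sub_sq_mul_log_sub_log_le hx hx1
      have h7 : 0 ≤ x ^ 7 := by positivity
      refine div_nonneg ?_ (by positivity)
      linarith
  have h : 0 < 1 + t ^ 2 := by positivity
  have := mul_nonneg h.le key
  field_simp at this
  linarith

theorem agMean_poly_bound_of_nonneg {t : ℝ} (ht : 0 ≤ t) (ht1 : t < 1) :
    16 * t ^ 2 + 4 * t ^ 4 + (1 + t ^ 2) * (log (1 + t ^ 2) - log (1 + t) - log (1 - t))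
      ≤ 9 * (t * (log (1 + t) - log (1 - t))) := by
  have key : 0 ≤ (9 * (t * (log (1 + t) - log (1 - t))) - (16 * t ^ 2 + 4 * t ^ 4)) / (1 + t ^ 2)
      - (log (1 + t ^ 2) - log (1 + t) - log (1 - t)) := by
    refine nonneg_of_hasDerivAt_nonneg_Ico (b := 1)
      (f := fun x => (9 * (x * (log (1 + x) - log (1 - x)))
        - (16 * x ^ 2 + 4 * x ^ 4)) / (1 + x ^ 2)
        - (log (1 + x ^ 2) - log (1 + x) - log (1 - x)))
      (f' := fun x => (9 * (1 - x ^ 2) ^ 2 * (log (1 + x) - log (1 - x))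
        + 14 * x * (1 + x ^ 2) - 2 * x * (1 - x ^ 2) * (16 + 8 * x ^ 2 + 4 * x ^ 4))
        / ((1 + x ^ 2) ^ 2 * ((1 + x) * (1 - x))))
      ?_ ?_ (by simp) ht ht1
    · intro x hx hx1
      have h1 : 0 < 1 + x := by linarith
      have h2 : 0 < 1 - x := by linarith
      have h3 : (1 + x ^ 2) ≠ 0 := by positivity
      refine ((((((hasDerivAt_id x).mul
          ((hasDerivAt_log_one_add h1).sub (hasDerivAt_log_one_sub h2))).const_mul 9).sub
        (((hasDerivAt_pow 2 x).const_mul 16).add ((hasDerivAt_pow 4 x).const_mul 4))).div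
        ((hasDerivAt_pow 2 x).const_add 1) h3).sub
        (((hasDerivAt_log_one_add_sq x).sub (hasDerivAt_log_one_add h1)).sub
          (hasDerivAt_log_one_sub h2))).congr_deriv ?_
      simp only [id, Pi.sub_apply, Pi.add_apply, Pi.mul_apply]
      field_simp
      push_cast
      ring
    · intro x hx hx1
      have h1 : 0 < 1 + x := by linarith
      have h2 : 0 < 1 - x := by linarith
      refine div_nonneg ?_ (by positivity)
      have := mul_le_mul_of_nonneg_left (two_mul_add_le_log_sub_log hx hx1)
        (by positivity : 0 ≤ 9 * (1 - x ^ 2) ^ 2)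
      have h5 : 0 ≤ x ^ 5 := by positivity
      have h7 : 0 ≤ x ^ 7 := by positivity
      linarith
  have h : 0 < 1 + t ^ 2 := by positivity
  have := mul_nonneg h.le key
  field_simp at this
  linarith

theorem jensenShannon_poly_bound {t : ℝ} (ht : -1 < t) (ht1 : t < 1) :
    3 * (2 * t * (log (1 + t) - log (1 - t))
      + (1 + t ^ 2) * (log (1 + t) + log (1 - t) - log (1 + t ^ 2)))
      ≤ 6 * t ^ 2 - 2 * t ^ 4 + t ^ 6 / 2 := by
  rcases le_total 0 t with h | h
  · exact jensenShannon_poly_bound_of_nonneg h ht1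
  · have := jensenShannon_poly_bound_of_nonneg (t := -t) (by linarith) (by linarith)
    simp only [sub_neg_eq_add, ← sub_eq_add_neg, even_two.neg_pow,
      (by decide : Even 4).neg_pow, (by decide : Even 6).neg_pow] at this
    linarith

theorem agMean_poly_bound {t : ℝ} (ht : -1 < t) (ht1 : t < 1) :
    16 * t ^ 2 + 4 * t ^ 4 + (1 + t ^ 2) * (log (1 + t ^ 2) - log (1 + t) - log (1 - t))
      ≤ 9 * (t * (log (1 + t) - log (1 - t))) := by
  rcases le_total 0 t with h | h
  · exact agMean_poly_bound_of_nonneg h ht1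
  · have := agMean_poly_bound_of_nonneg (t := -t) (by linarith) (by linarith)
    simp only [sub_neg_eq_add, ← sub_eq_add_neg, even_two.neg_pow,
      (by decide : Even 4).neg_pow] at this
    linarith

theorem le_sqrt_one_add {u : ℝ} (hu : 0 ≤ u) (hu1 : u ≤ 1) :
    1 + u / 2 - u ^ 2 / 8 + u ^ 3 / 32 ≤ √(1 + u) := by
  apply Real.le_sqrt_of_sq_le
  have h3 : 0 ≤ u ^ 3 * (1 - u) := mul_nonneg (by positivity) (by linarith)
  have h5 : 0 ≤ u ^ 5 * (1 - u) := mul_nonneg (by positivity) (by linarith)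
  have h5' : 0 ≤ u ^ 5 := by positivity
  have h3' : 0 ≤ u ^ 3 := by positivity
  linarith

/-- Two positive numbers written through half the sum of their square roots and the
relative difference of these square roots. -/
theorem exists_mul_one_add_sq_mul_one_sub_sq {p q : ℝ} (hp : 0 < p) (hq : 0 < q) :
    ∃ r t : ℝ, 0 < r ∧ -1 < t ∧ t < 1 ∧ p = (r * (1 + t)) ^ 2 ∧ q = (r * (1 - t)) ^ 2 := by
  have ha := Real.sqrt_pos.2 hp
  have hb := Real.sqrt_pos.2 hq
  refine ⟨(√p + √q) / 2, (√p - √q) / (√p + √q), by positivity, ?_, ?_, ?_, ?_⟩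
  · rw [lt_div_iff₀ (by positivity)]; linarith
  · rw [div_lt_iff₀ (by positivity)]; linarith
  · nth_rw 1 [← Real.sq_sqrt hp.le]
    congr 1
    field_simp
    ring
  · nth_rw 1 [← Real.sq_sqrt hq.le]
    congr 1
    field_simp
    ring

theorem sqrt_half_add_eq {r t : ℝ} (hr : 0 < r) :
    √(((r * (1 + t)) ^ 2 + (r * (1 - t)) ^ 2) / 2) = r * √(1 + t ^ 2) := by
  rw [show ((r * (1 + t)) ^ 2 + (r * (1 - t)) ^ 2) / 2 = r ^ 2 * (1 + t ^ 2) by ring,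
    Real.sqrt_mul (by positivity), Real.sqrt_sq hr.le]

theorem dDiv_jsDiv_term_le_hellinger_term {p q : ℝ} (hp : 0 < p) (hq : 0 < q) :
    16 * ((p + q) / 2 - (√p + √q) / 2 * √((p + q) / 2))
      + 3 / 2 * (p * log (2 * p / (p + q)) + q * log (2 * q / (p + q)))
      ≤ 7 / 2 * (√p - √q) ^ 2 := by
  obtain ⟨r, t, hr, ht, ht1, rfl, rfl⟩ := exists_mul_one_add_sq_mul_one_sub_sq hp hq
  have h1 : 0 < 1 + t := by linarith
  have h2 : 0 < 1 - t := by linarith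
  have h3 : 0 < 1 + t ^ 2 := by positivity
  rw [sqrt_half_add_eq hr, Real.sqrt_sq (by positivity), Real.sqrt_sq (by positivity)]
  rw [show 2 * (r * (1 + t)) ^ 2 / ((r * (1 + t)) ^ 2 + (r * (1 - t)) ^ 2)
      = (1 + t) ^ 2 / (1 + t ^ 2) by
        rw [show (r * (1 + t)) ^ 2 + (r * (1 - t)) ^ 2 = 2 * r ^ 2 * (1 + t ^ 2) by ring]
        field_simp,
    show 2 * (r * (1 - t)) ^ 2 / ((r * (1 + t)) ^ 2 + (r * (1 - t)) ^ 2)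
      = (1 - t) ^ 2 / (1 + t ^ 2) by
        rw [show (r * (1 + t)) ^ 2 + (r * (1 - t)) ^ 2 = 2 * r ^ 2 * (1 + t ^ 2) by ring]
        field_simp,
    Real.log_div (by positivity) h3.ne', Real.log_div (by positivity) h3.ne',
    Real.log_pow, Real.log_pow]
  have hA := jensenShannon_poly_bound ht ht1
  have hS := le_sqrt_one_add (sq_nonneg t) (by nlinarith)
  have key : 0 ≤ r ^ 2 * (14 * t ^ 2 - (16 * (1 + t ^ 2 - √(1 + t ^ 2))
      + 3 * (2 * t * (log (1 + t) - log (1 - t))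
      + (1 + t ^ 2) * (log (1 + t) + log (1 - t) - log (1 + t ^ 2))))) := by
    apply mul_nonneg (by positivity)
    linarith
  push_cast
  linarith

theorem hellinger_term_le_dDiv_triDelta_term {p q : ℝ} (hp : 0 < p) (hq : 0 < q) :
    10 * (√p - √q) ^ 2
      ≤ 64 * ((p + q) / 2 - (√p + √q) / 2 * √((p + q) / 2)) + (p - q) ^ 2 / (p + q) := by
  obtain ⟨r, t, hr, ht, ht1, rfl, rfl⟩ := exists_mul_one_add_sq_mul_one_sub_sq hp hq
  have h1 : 0 < 1 + t := by linarith
  have h2 : 0 < 1 - t := by linarith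
  have h3 : 0 < 1 + t ^ 2 := by positivity
  rw [sqrt_half_add_eq hr, Real.sqrt_sq (by positivity), Real.sqrt_sq (by positivity)]
  rw [show ((r * (1 + t)) ^ 2 - (r * (1 - t)) ^ 2) ^ 2 / ((r * (1 + t)) ^ 2 + (r * (1 - t)) ^ 2)
      = r ^ 2 * (8 * t ^ 2 / (1 + t ^ 2)) by
        rw [show (r * (1 + t)) ^ 2 + (r * (1 - t)) ^ 2 = 2 * r ^ 2 * (1 + t ^ 2) by ring]
        field_simp
        ring]
  obtain ⟨s, hs, hs0, hs2⟩ : ∃ s, s = √(1 + t ^ 2) ∧ 0 < s ∧ t ^ 2 = s ^ 2 - 1 :=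
    ⟨_, rfl, by positivity, by rw [Real.sq_sqrt h3.le]; ring⟩
  rw [← hs]
  have key : 0 ≤ r ^ 2 * (64 * (s ^ 2 - s) + 8 * (s ^ 2 - 1) / s ^ 2 - 40 * (s ^ 2 - 1)) := by
    apply mul_nonneg (by positivity)
    have hs1 : 0 ≤ s - 1 := by nlinarith [sq_nonneg t]
    rw [show 64 * (s ^ 2 - s) + 8 * (s ^ 2 - 1) / s ^ 2 - 40 * (s ^ 2 - 1)
      = 8 * (s - 1) ^ 3 * (3 * s + 1) / s ^ 2 by field_simp; ring]
    positivity
  rw [show 1 + t ^ 2 = s ^ 2 by linarith]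
  have e1 : 10 * (r * (1 + t) - r * (1 - t)) ^ 2 = r ^ 2 * (40 * (s ^ 2 - 1)) := by
    rw [← hs2]; ring
  have e2 : ((r * (1 + t)) ^ 2 + (r * (1 - t)) ^ 2) / 2 = r ^ 2 * s ^ 2 := by
    linear_combination r ^ 2 * hs2
  rw [e1, e2, hs2]
  linarith

theorem triDelta_term_le_dDiv_term {p q : ℝ} (hp : 0 < p) (hq : 0 < q) :
    (p - q) ^ 2 / (p + q) ≤ 16 * ((p + q) / 2 - (√p + √q) / 2 * √((p + q) / 2)) := by
  obtain ⟨r, t, hr, ht, ht1, rfl, rfl⟩ := exists_mul_one_add_sq_mul_one_sub_sq hp hq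
  have h1 : 0 < 1 + t := by linarith
  have h2 : 0 < 1 - t := by linarith
  have h3 : 0 < 1 + t ^ 2 := by positivity
  rw [sqrt_half_add_eq hr, Real.sqrt_sq (by positivity), Real.sqrt_sq (by positivity)]
  rw [show ((r * (1 + t)) ^ 2 - (r * (1 - t)) ^ 2) ^ 2 / ((r * (1 + t)) ^ 2 + (r * (1 - t)) ^ 2)
      = r ^ 2 * (8 * t ^ 2 / (1 + t ^ 2)) by
        rw [show (r * (1 + t)) ^ 2 + (r * (1 - t)) ^ 2 = 2 * r ^ 2 * (1 + t ^ 2) by ring]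
        field_simp
        ring]
  obtain ⟨s, hs, hs0, hs2⟩ : ∃ s, s = √(1 + t ^ 2) ∧ 0 < s ∧ t ^ 2 = s ^ 2 - 1 :=
    ⟨_, rfl, by positivity, by rw [Real.sq_sqrt h3.le]; ring⟩
  rw [← hs]
  have key : 0 ≤ r ^ 2 * (16 * (s ^ 2 - s) - 8 * (s ^ 2 - 1) / s ^ 2) := by
    apply mul_nonneg (by positivity)
    have hs1 : 0 ≤ s - 1 := by nlinarith [sq_nonneg t]
    rw [show 16 * (s ^ 2 - s) - 8 * (s ^ 2 - 1) / s ^ 2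
      = 8 * (s - 1) * ((s - 1) * (2 * s ^ 2 + 2 * s + 1)) / s ^ 2 by field_simp; ring]
    positivity
  have e2 : ((r * (1 + t)) ^ 2 + (r * (1 - t)) ^ 2) / 2 = r ^ 2 * s ^ 2 := by
    linear_combination r ^ 2 * hs2
  rw [show 1 + t ^ 2 = s ^ 2 by linarith, e2, hs2]
  linarith

theorem log_agDiv_term_eq {r t : ℝ} (hr : 0 < r) (ht : -1 < t) (ht1 : t < 1) :
    log (((r * (1 + t)) ^ 2 + (r * (1 - t)) ^ 2) /
      (2 * √((r * (1 + t)) ^ 2 * (r * (1 - t)) ^ 2)))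
      = log (1 + t ^ 2) - log (1 + t) - log (1 - t) := by
  have h1 : 0 < 1 + t := by linarith
  have h2 : 0 < 1 - t := by linarith
  rw [← mul_pow, Real.sqrt_sq (by positivity), sub_sub, ← Real.log_mul h1.ne' h2.ne',
    ← Real.log_div (by positivity) (by positivity)]
  congr 1
  field_simp
  ring

theorem dDiv_term_le_agDiv_term {p q : ℝ} (hp : 0 < p) (hq : 0 < q) :
    4 * ((p + q) / 2 - (√p + √q) / 2 * √((p + q) / 2))
      ≤ (p + q) / 2 * log ((p + q) / (2 * √(p * q))) := by
  obtain ⟨r, t, hr, ht, ht1, rfl, rfl⟩ := exists_mul_one_add_sq_mul_one_sub_sq hp hq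
  have h1 : 0 < 1 + t := by linarith
  have h2 : 0 < 1 - t := by linarith
  have h3 : 0 < 1 + t ^ 2 := by positivity
  rw [sqrt_half_add_eq hr, log_agDiv_term_eq hr ht ht1, Real.sqrt_sq (by positivity),
    Real.sqrt_sq (by positivity)]
  obtain ⟨s, hs, hs0, hs2⟩ : ∃ s, s = √(1 + t ^ 2) ∧ 0 < s ∧ 1 + t ^ 2 = s ^ 2 :=
    ⟨_, rfl, by positivity, by rw [Real.sq_sqrt h3.le]⟩
  have hlog : log (1 + t) + log (1 - t) ≤ - log (1 + t ^ 2) := by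
    rw [← Real.log_mul h1.ne' h2.ne', ← Real.log_inv]
    apply Real.log_le_log (by positivity)
    rw [le_inv_comm₀ (by positivity) h3, ← one_div, le_div_iff₀ (by positivity)]
    nlinarith [sq_nonneg (t ^ 2)]
  have hlog' : 1 - s⁻¹ ≤ log s := Real.one_sub_inv_le_log_of_pos hs0
  have hls : log (1 + t ^ 2) = 2 * log s := by rw [hs2, Real.log_pow]; norm_num
  have key : 0 ≤ r ^ 2 * (s ^ 2 *
      (log (1 + t ^ 2) - log (1 + t) - log (1 - t) - 4 * (1 - s⁻¹))) := by
    apply mul_nonneg (by positivity)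
    apply mul_nonneg (by positivity)
    linarith
  have e : s ^ 2 * s⁻¹ = s := by field_simp
  have e2 : ((r * (1 + t)) ^ 2 + (r * (1 - t)) ^ 2) / 2 = r ^ 2 * s ^ 2 := by
    rw [← hs2]; ring
  rw [e2, ← hs]
  linear_combination key + 4 * r ^ 2 * e

theorem dDiv_agDiv_term_le_jDiv_term {p q : ℝ} (hp : 0 < p) (hq : 0 < q) :
    32 * ((p + q) / 2 - (√p + √q) / 2 * √((p + q) / 2))
      + (p + q) / 2 * log ((p + q) / (2 * √(p * q)))
      ≤ 9 / 8 * ((p - q) * log (p / q)) := by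
  obtain ⟨r, t, hr, ht, ht1, rfl, rfl⟩ := exists_mul_one_add_sq_mul_one_sub_sq hp hq
  have h1 : 0 < 1 + t := by linarith
  have h2 : 0 < 1 - t := by linarith
  rw [sqrt_half_add_eq hr, log_agDiv_term_eq hr ht ht1, Real.sqrt_sq (by positivity),
    Real.sqrt_sq (by positivity), ← div_pow, mul_div_mul_left _ _ hr.ne', Real.log_pow,
    Real.log_div h1.ne' h2.ne']
  have hB := agMean_poly_bound ht ht1
  have hS := le_sqrt_one_add (sq_nonneg t) (by nlinarith)
  have h6 : 0 ≤ (t ^ 2) ^ 3 := by positivity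
  have key : 0 ≤ r ^ 2 * (9 * (t * (log (1 + t) - log (1 - t)))
      - (32 * (1 + t ^ 2 - √(1 + t ^ 2))
      + (1 + t ^ 2) * (log (1 + t ^ 2) - log (1 + t) - log (1 - t)))) := by
    apply mul_nonneg (by positivity)
    linarith
  push_cast
  linarith

theorem dDiv_eq_sum {n : ℕ} {p q : Fin n → ℝ} (hp : p ∈ ProbDist n) (hq : q ∈ ProbDist n) :
    dDiv p q = ∑ i, ((p i + q i) / 2 - (√(p i) + √(q i)) / 2 * √((p i + q i) / 2)) := by
  rw [dDiv, Finset.sum_sub_distrib, ← Finset.sum_div, Finset.sum_add_distrib, hp.2, hq.2]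
  norm_num

theorem chain_I_d_J (n : ℕ) (hn : 2 ≤ n)
    (p q : Fin n → ℝ) (hp : p ∈ ProbDist n) (hq : q ∈ ProbDist n) :
    jsDiv p q ≤ (16 * dDiv p q + 3 * jsDiv p q) / 7 ∧
    (16 * dDiv p q + 3 * jsDiv p q) / 7 ≤ hellinger p q ∧
    hellinger p q ≤ (64 * dDiv p q + triDelta p q) / 20 ∧
    (64 * dDiv p q + triDelta p q) / 20 ≤ 4 * dDiv p q ∧
    4 * dDiv p q ≤ (32 * dDiv p q + agDiv p q) / 9 ∧
    (32 * dDiv p q + agDiv p q) / 9 ≤ (1 / 8) * jDiv p q := by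
  have hIh := Finset.sum_le_sum fun i (_ : i ∈ Finset.univ) =>
    dDiv_jsDiv_term_le_hellinger_term (hp.1 i) (hq.1 i)
  have hhΔ := Finset.sum_le_sum fun i (_ : i ∈ Finset.univ) =>
    hellinger_term_le_dDiv_triDelta_term (hp.1 i) (hq.1 i)
  have hΔd := Finset.sum_le_sum fun i (_ : i ∈ Finset.univ) =>
    triDelta_term_le_dDiv_term (hp.1 i) (hq.1 i)
  have hdT := Finset.sum_le_sum fun i (_ : i ∈ Finset.univ) =>
    dDiv_term_le_agDiv_term (hp.1 i) (hq.1 i)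
  have hTJ := Finset.sum_le_sum fun i (_ : i ∈ Finset.univ) =>
    dDiv_agDiv_term_le_jDiv_term (hp.1 i) (hq.1 i)
  simp only [Finset.sum_add_distrib, ← Finset.mul_sum, ← dDiv_eq_sum hp hq]
    at hIh hhΔ hΔd hdT hTJ
  simp only [jsDiv, hellinger, triDelta, agDiv, jDiv]
  refine ⟨?_, ?_, ?_, ?_, ?_, ?_⟩ <;> linarith
end

section
/- For every real s and every n ≥ 2: (i) ζ_s(P||Q) ≥ 0 for all P, Q ∈ Γₙ, and (ii) the map (P,Q) ↦ ζ_s(P||Q) is convex on the convex set Γₙ × Γₙ ⊆ ℝⁿ × ℝⁿ. -/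
open Real BigOperators Finset

/-- The J-divergence of type s, ζ_s(P‖Q). -/
noncomputable def zeta {n : ℕ} (s : ℝ) (p q : Fin n → ℝ) : ℝ :=
  if s = 0 ∨ s = 1 then jDiv p q
  else (s * (s - 1))⁻¹ *
    ((∑ i, (p i ^ s * q i ^ (1 - s) + p i ^ (1 - s) * q i ^ s)) - 2)

/-- The perspective `(x, y) ↦ y f(x / y)` of a convex function on the positive half-line
is jointly convex. -/
theorem convexOn_perspective {f : ℝ → ℝ} (hf : ConvexOn ℝ (Set.Ioi 0) f) :
    ConvexOn ℝ (Set.Ioi (0 : ℝ) ×ˢ Set.Ioi (0 : ℝ))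
      (fun x : ℝ × ℝ => x.2 * f (x.1 / x.2)) := by
  refine ⟨(convex_Ioi 0).prod (convex_Ioi 0), ?_⟩
  rintro ⟨x₁, y₁⟩ ⟨hx₁, hy₁⟩ ⟨x₂, y₂⟩ ⟨hx₂, hy₂⟩ a b ha hb hab
  simp only [Set.mem_Ioi] at hx₁ hy₁ hx₂ hy₂
  simp only [Prod.smul_mk, Prod.mk_add_mk, smul_eq_mul]
  have hy : 0 < a * y₁ + b * y₂ :=
    (convex_Ioi (0 : ℝ)) (Set.mem_Ioi.2 hy₁) (Set.mem_Ioi.2 hy₂) ha hb hab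
  have h := hf.2 (Set.mem_Ioi.2 (div_pos hx₁ hy₁)) (Set.mem_Ioi.2 (div_pos hx₂ hy₂))
    (div_nonneg (mul_nonneg ha hy₁.le) hy.le) (div_nonneg (mul_nonneg hb hy₂.le) hy.le)
    (by rw [← add_div, div_self hy.ne'])
  simp only [smul_eq_mul] at h
  have harg : a * y₁ / (a * y₁ + b * y₂) * (x₁ / y₁) + b * y₂ / (a * y₁ + b * y₂) * (x₂ / y₂)
      = (a * x₁ + b * x₂) / (a * y₁ + b * y₂) := by
    field_simp
  rw [harg] at h
  refine (mul_le_mul_of_nonneg_left h hy.le).trans_eq ?_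
  field_simp

/-- The Csiszár divergence of two positive distributions generated by a convex function
vanishing at `1` is nonnegative. -/
theorem csiszar_nonneg {n : ℕ} {f : ℝ → ℝ} (hf : ConvexOn ℝ (Set.Ioi 0) f) (hf1 : f 1 = 0)
    {p q : Fin n → ℝ} (hp : p ∈ ProbDist n) (hq : q ∈ ProbDist n) :
    0 ≤ ∑ i, q i * f (p i / q i) := by
  have h := hf.map_sum_le (t := Finset.univ) (w := q) (p := fun i => p i / q i)
    (fun i _ => (hq.1 i).le) hq.2 (fun i _ => div_pos (hp.1 i) (hq.1 i))
  have hsum : ∑ i, q i * (p i / q i) = 1 := by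
    rw [← hp.2]
    exact Finset.sum_congr rfl fun i _ => mul_div_cancel₀ _ (hq.1 i).ne'
  simpa only [smul_eq_mul, hsum, hf1] using h

theorem convex_probDist (n : ℕ) : Convex ℝ (ProbDist n) := by
  intro p hp q hq a b ha hb hab
  refine ⟨fun i => (convex_Ioi (0 : ℝ)) (hp.1 i) (hq.1 i) ha hb hab, ?_⟩
  simp only [Pi.add_apply, Pi.smul_apply, smul_eq_mul, Finset.sum_add_distrib,
    ← Finset.mul_sum, hp.2, hq.2, mul_one, hab]

/-- The Csiszár divergence generated by a convex function is jointly convex. -/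
theorem convexOn_csiszar (n : ℕ) {f : ℝ → ℝ} (hf : ConvexOn ℝ (Set.Ioi 0) f) :
    ConvexOn ℝ (ProbDist n ×ˢ ProbDist n)
      (fun x : (Fin n → ℝ) × (Fin n → ℝ) => ∑ i, x.2 i * f (x.1 i / x.2 i)) := by
  refine ⟨(convex_probDist n).prod (convex_probDist n), ?_⟩
  rintro ⟨p₁, q₁⟩ ⟨hp₁, hq₁⟩ ⟨p₂, q₂⟩ ⟨hp₂, hq₂⟩ a b ha hb hab
  simp only [smul_eq_mul, Finset.mul_sum, ← Finset.sum_add_distrib]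
  exact Finset.sum_le_sum fun i _ => (convexOn_perspective hf).2
    (x := (p₁ i, q₁ i)) ⟨hp₁.1 i, hq₁.1 i⟩ (y := (p₂ i, q₂ i)) ⟨hp₂.1 i, hq₂.1 i⟩ ha hb hab

theorem convexOn_rpow_div {r : ℝ} (h0 : r ≠ 0) (h1 : r ≠ 1) :
    ConvexOn ℝ (Set.Ioi 0) (fun t : ℝ => (r * (r - 1))⁻¹ * t ^ r) := by
  have hr : r - 1 ≠ 0 := sub_ne_zero.2 h1
  have hd1 : ∀ t ∈ Set.Ioi (0 : ℝ), HasDerivAt (fun t : ℝ => (r * (r - 1))⁻¹ * t ^ r)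
      ((r - 1)⁻¹ * t ^ (r - 1)) t := fun t ht => by
    refine ((Real.hasDerivAt_rpow_const (Or.inl (ne_of_gt ht))).const_mul _).congr_deriv ?_
    field_simp
  have hd2 : ∀ t ∈ Set.Ioi (0 : ℝ), HasDerivAt (fun t : ℝ => (r - 1)⁻¹ * t ^ (r - 1))
      (t ^ (r - 1 - 1)) t := fun t ht => by
    refine ((Real.hasDerivAt_rpow_const (Or.inl (ne_of_gt ht))).const_mul _).congr_deriv ?_
    field_simp
  refine convexOn_of_hasDerivWithinAt2_nonneg (convex_Ioi 0)
    (fun t ht => (hd1 t ht).continuousAt.continuousWithinAt)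
    (fun t ht => (hd1 t (interior_subset ht)).hasDerivWithinAt)
    (fun t ht => (hd2 t (interior_subset ht)).hasDerivWithinAt)
    (fun t ht => Real.rpow_nonneg (le_of_lt (interior_subset ht)) _)

/-- The convex generator of `zeta s` as a Csiszár divergence. -/
noncomputable def zetaGen (s t : ℝ) : ℝ :=
  if s = 0 ∨ s = 1 then (t - 1) * Real.log t
  else (s * (s - 1))⁻¹ * (t ^ s + t ^ (1 - s) - 1 - t)

theorem zetaGen_one (s : ℝ) : zetaGen s 1 = 0 := by
  simp [zetaGen]

theorem convexOn_zetaGen (s : ℝ) : ConvexOn ℝ (Set.Ioi 0) (zetaGen s) := by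
  by_cases hs : s = 0 ∨ s = 1
  · refine ((Real.convexOn_mul_log.subset Set.Ioi_subset_Ici_self (convex_Ioi 0)).sub
      strictConcaveOn_log_Ioi.concaveOn).congr fun t _ => ?_
    simp only [zetaGen, if_pos hs, Pi.sub_apply]
    ring
  · obtain ⟨h0, h1⟩ := not_or.1 hs
    have h := (convexOn_rpow_div h0 h1).add
      (convexOn_rpow_div (sub_ne_zero.2 (Ne.symm h1)) (by simpa using h0 : 1 - s ≠ 1))
    have hlin : ConvexOn ℝ (Set.Ioi 0) (fun t : ℝ => -(s * (s - 1))⁻¹ * (t + 1)) := by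
      refine ⟨convex_Ioi 0, fun x _ y _ a b _ _ hab => le_of_eq ?_⟩
      simp only [smul_eq_mul]
      linear_combination -(-(s * (s - 1))⁻¹) * (hab)
    refine (h.add hlin).congr fun t _ => ?_
    simp only [zetaGen, if_neg hs, Pi.add_apply,
      show (1 - s) * (1 - s - 1) = s * (s - 1) by ring]
    ring

theorem zeta_eq_sum_zetaGen {n : ℕ} (s : ℝ) {p q : Fin n → ℝ} (hp : p ∈ ProbDist n)
    (hq : q ∈ ProbDist n) : zeta s p q = ∑ i, q i * zetaGen s (p i / q i) := by
  by_cases hs : s = 0 ∨ s = 1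
  · simp only [zeta, zetaGen, if_pos hs, jDiv]
    refine Finset.sum_congr rfl fun i _ => ?_
    have := (hq.1 i).ne'
    field_simp
  · simp only [zeta, zetaGen, if_neg hs]
    have h2 : (2 : ℝ) = ∑ i, (p i + q i) := by
      rw [Finset.sum_add_distrib, hp.2, hq.2]
      norm_num
    rw [h2, ← Finset.sum_sub_distrib, Finset.mul_sum]
    refine Finset.sum_congr rfl fun i _ => ?_
    have hpi := hp.1 i
    have hqi := hq.1 i
    have hpow : ∀ r : ℝ, q i * (p i / q i) ^ r = p i ^ r * q i ^ (1 - r) := fun r => by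
      rw [Real.div_rpow hpi.le hqi.le, Real.rpow_sub hqi, Real.rpow_one]
      ring
    have e1 := hpow s
    have e2 := hpow (1 - s)
    rw [sub_sub_cancel] at e2
    have e3 : q i * (p i / q i) = p i := mul_div_cancel₀ _ hqi.ne'
    linear_combination (s * (s - 1))⁻¹ * (e3 - e1 - e2)

theorem zeta_nonneg_and_convex (s : ℝ) (n : ℕ) (hn : 2 ≤ n) :
    (∀ p ∈ ProbDist n, ∀ q ∈ ProbDist n, 0 ≤ zeta s p q) ∧
    ConvexOn ℝ ((ProbDist n) ×ˢ (ProbDist n))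
      (fun x : (Fin n → ℝ) × (Fin n → ℝ) => zeta s x.1 x.2) := by
  refine ⟨fun p hp q hq => ?_, ?_⟩
  · rw [zeta_eq_sum_zetaGen s hp hq]
    exact csiszar_nonneg (convexOn_zetaGen s) (zetaGen_one s) hp hq
  · exact (convexOn_csiszar n (convexOn_zetaGen s)).congr fun x hx =>
      (zeta_eq_sum_zetaGen s hx.1 hx.2).symm
end
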